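/- arXiv:1411.7280 — 7 statements merged into one kernel-verified Lean document; each statement's English description precedes it below -/
import Mathlib

section
/- Let n and T be positive integers and suppose there is a finite family of real n-variate polynomials p_i, each of degree at most T, such that (x_1+...+x_n - 1)(x_1+...+x_n - 2) = Σ_i p_i(x)^2 for every x ∈ {0,1}^n. Then T ≥ √(n/48). Equivalently, the sum-of-squares degree of the function f(x) = (|x|-1)(|x|-2) on {0,1}^n is at least √(n/48). -/
open Polynomial in
/-- Endpoint Markov inequality on the segment between `a` and `b`. -/
lemma markov_endpoint (g : ℝ[X]) (d : ℕ) (hd : g.natDegree ≤ d) (a b B : ℝ) (hB : 0 < B)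
    (hg : ∀ x ∈ Set.uIcc a b, |g.eval x| ≤ B) :
    |g.derivative.eval b| * |b - a| ≤ 2 * (d : ℝ) ^ 2 * B := by
  have key : ∀ s : ℝ, |s| = 1 → s * (g.derivative.eval b * (b - a)) ≤ 2 * (d : ℝ) ^ 2 * B := by
    intro s hs
    set P : ℝ[X] := C (s / B) * g.comp (C ((a + b) / 2) + C ((b - a) / 2) * X) with hP
    have hdeg : P.degree ≤ d := by
      apply degree_le_of_natDegree_le
      refine (natDegree_C_mul_le _ _).trans (natDegree_comp_le.trans ?_)
      have h1 : (C ((a + b) / 2) + C ((b - a) / 2) * X : ℝ[X]).natDegree ≤ 1 := by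
        compute_degree
      calc _ ≤ d * 1 := Nat.mul_le_mul hd h1
        _ = d := mul_one d
    have hbd : ∀ x ∈ Set.Icc (-1 : ℝ) 1, |P.eval x| ≤ 1 := by
      intro x hx
      have hmem : (a + b) / 2 + (b - a) / 2 * x ∈ Set.uIcc a b := by
        rw [Set.mem_uIcc]
        obtain ⟨h1, h2⟩ := hx
        rcases le_total a b with h | h
        · left; constructor <;> nlinarith
        · right; constructor <;> nlinarith
      have h3 := hg _ hmem
      simp only [hP, eval_mul, eval_C, eval_comp, eval_add, eval_X, abs_mul, abs_div, hs,
        abs_of_pos hB]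
      rw [div_mul_eq_mul_div, one_mul]
      exact (div_le_one hB).2 h3
    have h := Polynomial.Chebyshev.eval_iterate_derivative_le_of_forall_abs_le_one (n := d)
      (P := P) (k := 1) (x := 1) le_rfl hdeg hbd
    simp only [Function.iterate_one, Polynomial.Chebyshev.derivative_T_eval_one] at h
    have h2 : P.derivative.eval 1 = (s / B) * ((b - a) / 2 * g.derivative.eval b) := by
      have : (a + b) / 2 + (b - a) / 2 = b := by ring
      simp [hP, derivative_comp, this]
    rw [h2] at h
    have h3 := mul_le_mul_of_nonneg_left h (by positivity : 0 ≤ 2 * B)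
    have h4 : 2 * B * ((s / B) * ((b - a) / 2 * g.derivative.eval b))
        = s * (g.derivative.eval b * (b - a)) := by
      field_simp
    rw [h4] at h3
    refine h3.trans (le_of_eq ?_)
    push_cast
    ring
  rw [← abs_mul, abs_le]
  constructor
  · have := key (-1) (by simp)
    linarith
  · have := key 1 (by simp)
    linarith

open Polynomial in
/-- Univariate core. -/
lemma univariate_core (g : ℝ[X]) (d n : ℕ) (hn : 2 ≤ n) (hd : g.natDegree ≤ d)
    (h0 : g.eval 0 = -2) (h2 : g.eval 2 = 0)
    (hk : ∀ k : ℕ, 2 ≤ k → k ≤ n → |g.eval (k : ℝ)| ≤ 3 / 2) :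
    (n : ℝ) ≤ 10 * (d : ℝ) ^ 2 := by
  have hnR : (2 : ℝ) ≤ n := by exact_mod_cast hn
  obtain ⟨y, hy, hmax⟩ := (isCompact_Icc (a := (0 : ℝ)) (b := n)).exists_isMaxOn
    ⟨0, by simp⟩ (f := fun x => |g.derivative.eval x|) (by fun_prop)
  set M := |g.derivative.eval y| with hM
  have hM' : ∀ x ∈ Set.Icc (0 : ℝ) n, |g.derivative.eval x| ≤ M := fun x hx => hmax hx
  have lip : ∀ x ∈ Set.Icc (0 : ℝ) n, ∀ z ∈ Set.Icc (0 : ℝ) n,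
      |g.eval z - g.eval x| ≤ M * |z - x| := by
    intro x hx z hz
    have := (convex_Icc (0 : ℝ) n).norm_image_sub_le_of_norm_deriv_le (f := fun x => g.eval x)
      (C := M) (fun x _ => g.differentiableAt) (fun x hx => by
        rw [Polynomial.deriv]; exact hM' x hx) hx hz
    simpa using this
  have hM1 : 1 ≤ M := by
    have := lip 0 (by simp) 2 ⟨by norm_num, hnR⟩
    rw [h0, h2] at this
    norm_num at this
    linarith
  have hbd : ∀ x ∈ Set.Icc (0 : ℝ) n, |g.eval x| ≤ 5 / 2 * M := by
    intro x hx
    obtain ⟨hx0, hxn⟩ := hx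
    rcases le_total x 2 with h | h
    · have := lip 2 ⟨by norm_num, hnR⟩ x ⟨hx0, hxn⟩
      rw [h2, sub_zero] at this
      have h3 : |x - 2| ≤ 2 := by rw [abs_le]; constructor <;> linarith
      nlinarith
    · have hf1 := Nat.floor_le hx0
      have hf2 := Nat.lt_floor_add_one x
      have hf3 : 2 ≤ ⌊x⌋₊ := Nat.le_floor (by exact_mod_cast h)
      have hf4 : ⌊x⌋₊ ≤ n := by exact_mod_cast hf1.trans hxn
      have hl := lip (⌊x⌋₊ : ℝ) ⟨by positivity, by exact_mod_cast hf4⟩ x ⟨hx0, hxn⟩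
      have hkk := hk _ hf3 hf4
      have h3 : |x - ⌊x⌋₊| ≤ 1 := by rw [abs_le]; constructor <;> linarith
      have h4 := abs_sub_abs_le_abs_sub (g.eval x) (g.eval (⌊x⌋₊ : ℝ))
      nlinarith
  have fin : ∀ a ∈ Set.Icc (0 : ℝ) n, (n : ℝ) / 2 ≤ |y - a| → (n : ℝ) ≤ 10 * (d : ℝ) ^ 2 := by
    intro a ha hay
    have hm := markov_endpoint g d hd a y (5 / 2 * M) (by linarith)
      (fun x hx => hbd x ((Set.uIcc_subset_Icc ha hy) hx))
    rw [← hM] at hm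
    have h5 : M * (n / 2) ≤ M * (5 * (d : ℝ) ^ 2) := by
      refine (mul_le_mul_of_nonneg_left hay (by linarith)).trans (hm.trans (le_of_eq (by ring)))
    have := le_of_mul_le_mul_left h5 (by linarith)
    linarith
  rcases le_total (n / 2 : ℝ) y with h | h
  · exact fin 0 (by simp) (by rw [sub_zero]; exact h.trans (le_abs_self y))
  · refine fin n (by simp) ?_
    rw [abs_sub_comm]
    exact le_trans (by linarith) (le_abs_self _)

/-- Indicator vector of a finite set. -/
noncomputable def indVec {n : ℕ} (S : Finset (Fin n)) : Fin n → ℝ := fun i => if i ∈ S then 1 else 0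

lemma eval_monomial_indVec {n : ℕ} (S : Finset (Fin n)) (u : Fin n →₀ ℕ) (c : ℝ) :
    MvPolynomial.eval (indVec S) (MvPolynomial.monomial u c) = if u.support ⊆ S then c else 0 := by
  rw [MvPolynomial.eval_monomial, Finsupp.prod]
  split_ifs with h
  · rw [Finset.prod_eq_one, mul_one]
    intro i hi
    simp [indVec, h hi]
  · obtain ⟨i, hi, hiS⟩ := Finset.not_subset.1 h
    rw [Finset.prod_eq_zero hi, mul_zero]
    simp only [indVec, hiS, if_false]
    exact zero_pow (Finsupp.mem_support_iff.1 hi)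

lemma count_supersets {n : ℕ} (U : Finset (Fin n)) (k : ℕ) :
    ((Finset.powersetCard k (Finset.univ : Finset (Fin n))).filter (fun S => U ⊆ S)).card
      * (n.choose U.card) = n.choose k * k.choose U.card := by
  by_cases hk : U.card ≤ k
  · have h1 : ((Finset.powersetCard k (Finset.univ : Finset (Fin n))).filter (fun S => U ⊆ S)).card
        = (n - U.card).choose (k - U.card) := by
      have : (Finset.powersetCard (k - U.card) Uᶜ).card = (n - U.card).choose (k - U.card) := by
        rw [Finset.card_powersetCard, Finset.card_compl, Fintype.card_fin]
      rw [← this]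
      refine Finset.card_bij' (fun S _ => S \ U) (fun S _ => S ∪ U) ?_ ?_ ?_ ?_
      · intro S hS
        simp only [Finset.mem_filter, Finset.mem_powersetCard] at hS
        rw [Finset.mem_powersetCard, Finset.card_sdiff_of_subset hS.2, hS.1.2]
        exact ⟨by intro x; simp, rfl⟩
      · intro S hS
        rw [Finset.mem_powersetCard] at hS
        have hdis : Disjoint S U := by
          rw [Finset.disjoint_left]
          intro x hx
          simpa using hS.1 hx
        simp only [Finset.mem_filter, Finset.mem_powersetCard, Finset.card_union_of_disjoint hdis]
        refine ⟨⟨Finset.subset_univ _, by omega⟩, Finset.subset_union_right⟩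
      · intro S hS
        simp only [Finset.mem_filter] at hS
        exact Finset.sdiff_union_of_subset hS.2
      · intro S hS
        rw [Finset.mem_powersetCard] at hS
        ext x
        have := @hS.1 x
        simp at this ⊢
        tauto
    rw [h1, mul_comm]
    by_cases hkn : k ≤ n
    · exact (Nat.choose_mul hk).symm
    · have : U.card ≤ n := by simpa using U.card_le_univ
      rw [Nat.choose_eq_zero_of_lt (by omega : n < k), zero_mul,
        Nat.choose_eq_zero_of_lt (by omega : n - U.card < k - U.card), mul_zero]
  · rw [Nat.choose_eq_zero_of_lt (by omega : k < U.card), mul_zero, Finset.card_eq_zero.2, zero_mul]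
    apply Finset.filter_eq_empty_iff.2
    intro S hS hU
    rw [Finset.mem_powersetCard] at hS
    have := Finset.card_le_card hU
    omega

open Polynomial in
lemma symmetrize {n : ℕ} (P : MvPolynomial (Fin n) ℝ) (T : ℕ) (hP : P.totalDegree ≤ T) :
    ∃ q : ℝ[X], q.natDegree ≤ T ∧ ∀ k : ℕ,
      ∑ S ∈ Finset.powersetCard k (Finset.univ : Finset (Fin n)), MvPolynomial.eval (indVec S) P
        = (n.choose k : ℝ) * q.eval (k : ℝ) := by
  refine ⟨∑ u ∈ P.support, C (P.coeff u / ((n.choose u.support.card : ℝ) * u.support.card.factorial))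
    * descPochhammer ℝ u.support.card, ?_, ?_⟩
  · apply natDegree_sum_le_of_forall_le
    intro u hu
    refine (natDegree_C_mul_le _ _).trans ?_
    rw [descPochhammer_natDegree]
    refine le_trans ?_ ((MvPolynomial.le_totalDegree hu).trans hP)
    rw [Finsupp.sum, Finset.card_eq_sum_ones]
    apply Finset.sum_le_sum
    intro i hi
    exact Nat.one_le_iff_ne_zero.2 (Finsupp.mem_support_iff.1 hi)
  · intro k
    conv_lhs =>
      enter [2, S]
      rw [P.as_sum, map_sum]
      simp only [eval_monomial_indVec]
    rw [Finset.sum_comm, eval_finsetSum, Finset.mul_sum]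
    apply Finset.sum_congr rfl
    intro u hu
    rw [← Finset.sum_filter, Finset.sum_const, nsmul_eq_mul, eval_mul, eval_C,
      descPochhammer_eval_eq_descFactorial, Nat.descFactorial_eq_factorial_mul_choose]
    have h := count_supersets u.support k
    have h' := congrArg (Nat.cast : ℕ → ℝ) h
    push_cast at h' ⊢
    have hc : (n.choose u.support.card : ℝ) ≠ 0 := by
      have : u.support.card ≤ n := by simpa using u.support.card_le_univ
      exact_mod_cast (Nat.choose_pos this).ne'
    have hf : (u.support.card.factorial : ℝ) ≠ 0 := by positivity
    field_simp
    linear_combination P.coeff u * h'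

/-- If `(|x|-1)(|x|-2)` equals a sum of squares of `n`-variate real
polynomials of degree at most `T` on the Boolean cube, then `T ≥ √(n/48)`. -/
theorem sos_degree_lower_bound (n T : ℕ) (hn : 0 < n) (hT : 0 < T)
    (m : ℕ) (p : Fin m → MvPolynomial (Fin n) ℝ)
    (hdeg : ∀ i, (p i).totalDegree ≤ T)
    (hrep : ∀ x : Fin n → ℝ, (∀ i, x i = 0 ∨ x i = 1) →
      ((∑ i, x i) - 1) * ((∑ i, x i) - 2) = ∑ i, (MvPolynomial.eval x (p i)) ^ 2) :
    Real.sqrt ((n : ℝ) / 48) ≤ (T : ℝ) := by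
  rw [Real.sqrt_le_left (by positivity)]
  have hT1 : (1 : ℝ) ≤ T := by exact_mod_cast hT
  rcases lt_or_ge n 2 with hn2 | hn2
  · have : (n : ℝ) ≤ 2 := by exact_mod_cast hn2.le
    nlinarith
  set P : MvPolynomial (Fin n) ℝ :=
    ∑ i, MvPolynomial.C (MvPolynomial.eval (indVec ∅) (p i)) * p i with hP
  have hPdeg : P.totalDegree ≤ T := by
    apply MvPolynomial.totalDegree_finsetSum_le
    intro i _
    refine (MvPolynomial.totalDegree_mul _ _).trans ?_
    rw [MvPolynomial.totalDegree_C, zero_add]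
    exact hdeg i
  have hrepS : ∀ S : Finset (Fin n), ((S.card : ℝ) - 1) * ((S.card : ℝ) - 2)
      = ∑ i, (MvPolynomial.eval (indVec S) (p i)) ^ 2 := by
    intro S
    rw [← hrep (indVec S) (fun i => by simp only [indVec]; split_ifs <;> simp)]
    simp [indVec]
  have hPS : ∀ S : Finset (Fin n), MvPolynomial.eval (indVec S) P
      = ∑ i, MvPolynomial.eval (indVec ∅) (p i) * MvPolynomial.eval (indVec S) (p i) := by
    intro S
    simp [hP]
  have hsq : ∀ S : Finset (Fin n), (MvPolynomial.eval (indVec S) P) ^ 2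
      ≤ 2 * (((S.card : ℝ) - 1) * ((S.card : ℝ) - 2)) := by
    intro S
    have h0 := hrepS ∅
    rw [hPS]
    refine (Finset.sum_mul_sq_le_sq_mul_sq _ _ _).trans (le_of_eq ?_)
    rw [← h0, ← hrepS S]
    norm_num
  have hP0 : MvPolynomial.eval (indVec ∅) P = 2 := by
    have h0 := hrepS ∅
    rw [hPS]
    simp only [← pow_two]
    rw [← h0]
    norm_num
  obtain ⟨q, hqd, hq⟩ := symmetrize P T hPdeg
  have hq0 : q.eval 0 = 2 := by
    have := hq 0
    simpa [hP0] using this.symm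
  have hqk : ∀ k : ℕ, 1 ≤ k → k ≤ n → ∀ B : ℝ, 0 ≤ B →
      2 * (((k : ℝ) - 1) * ((k : ℝ) - 2)) ≤ B ^ 2 → |q.eval (k : ℝ)| ≤ B := by
    intro k _ hkn B hB hBk
    have hc : (0 : ℝ) < n.choose k := by exact_mod_cast Nat.choose_pos hkn
    have h1 : |(n.choose k : ℝ) * q.eval (k : ℝ)| ≤ (n.choose k : ℝ) * B := by
      rw [← hq k]
      refine (Finset.abs_sum_le_sum_abs _ _).trans ?_
      refine (Finset.sum_le_card_nsmul _ _ B ?_).trans (le_of_eq ?_)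
      · intro S hS
        rw [Finset.mem_powersetCard] at hS
        apply abs_le_of_sq_le_sq _ hB
        have := hsq S
        rw [hS.2] at this
        linarith
      · simp
    rw [abs_mul, abs_of_pos hc] at h1
    exact le_of_mul_le_mul_left h1 hc
  have hq1 : q.eval 1 = 0 := by
    have := hqk 1 le_rfl (by omega) 0 le_rfl (by norm_num)
    simpa using this
  have hq2 : q.eval 2 = 0 := by
    have := hqk 2 (by omega) (by omega) 0 le_rfl (by norm_num)
    simpa using this
  obtain ⟨g, hg⟩ := Polynomial.dvd_iff_isRoot.2 hq1
  have hge : ∀ x : ℝ, q.eval x = (x - 1) * g.eval x := by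
    intro x
    rw [hg]
    simp
  have hgd : g.natDegree ≤ T := by
    refine le_trans (Polynomial.natDegree_le_of_dvd ⟨_, by rw [hg, mul_comm]⟩ ?_) hqd
    intro h
    rw [h] at hq0
    simp at hq0
  have main := univariate_core g T n hn2 hgd (by have := hge 0; rw [hq0] at this; linarith)
    (by have := hge 2; rw [hq2] at this; linarith) (by
      intro k hk hkn
      have hkR : (2 : ℝ) ≤ k := by exact_mod_cast hk
      have h := hqk k (by omega) hkn (3 / 2 * ((k : ℝ) - 1)) (by linarith) (by nlinarith)
      rw [hge, abs_mul, abs_of_pos (by linarith : (0 : ℝ) < (k : ℝ) - 1)] at h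
      refine le_of_mul_le_mul_left (h.trans (le_of_eq (mul_comm _ _)))
        (by linarith : (0 : ℝ) < (k : ℝ) - 1))
  nlinarith
end

section
/- Let p be a real polynomial in n variables of degree at most T. Then there exists a univariate real polynomial q of degree at most T such that for every integer k with 0 ≤ k ≤ n, q(k) equals the average of p(x) over all x ∈ {0,1}^n of Hamming weight k, i.e., q(k) = (1 / C(n,k)) · Σ_{x ∈ {0,1}^n, |x|=k} p(x). -/
lemma symm_count (n k : ℕ) (S : Finset (Fin n)) :
    n.choose k * k.choose S.card =
      n.choose S.card *
        (((Finset.univ : Finset (Fin n)).powersetCard k).filter (S ⊆ ·)).card := by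
  by_cases h : S.card ≤ k
  · rw [Finset.card_filter_powersetCard_subset S _ k (Finset.subset_univ S) h,
      Nat.choose_mul h, Finset.card_univ, Fintype.card_fin]
  · rw [Nat.choose_eq_zero_of_lt (not_le.mp h), Finset.filter_eq_empty_iff.mpr]
    · simp
    · intro x hx hS
      have := Finset.card_le_card hS
      rw [(Finset.mem_powersetCard.mp hx).2] at this
      exact h this

lemma symm_sum (n k : ℕ) (d : Fin n →₀ ℕ) :
    ∑ x ∈ Finset.univ.filter
        (fun x : Fin n → Bool => (Finset.univ.filter fun i => x i).card = k),
      ∏ i, (if x i then (1 : ℝ) else 0) ^ d i =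
    ((((Finset.univ : Finset (Fin n)).powersetCard k).filter (d.support ⊆ ·)).card : ℝ) := by
  rw [Finset.card_filter, Nat.cast_sum]
  refine Finset.sum_bij' (fun x _ => Finset.univ.filter fun i => x i = true)
    (fun s _ => fun i => decide (i ∈ s)) ?_ ?_ ?_ ?_ ?_
  · intro x hx
    simpa [Finset.mem_powersetCard] using hx
  · intro s hs
    simpa [Finset.mem_powersetCard] using hs
  · intro x hx
    ext i
    simp
  · intro s hs
    ext i
    simp
  · intro x hx
    split_ifs with h
    · rw [Nat.cast_one]
      refine Finset.prod_eq_one fun i _ => ?_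
      by_cases hi : d i = 0
      · simp [hi]
      · have := h (Finsupp.mem_support_iff.mpr hi)
        simp at this
        simp [this]
    · obtain ⟨i, hi, hmem⟩ := Finset.not_subset.mp h
      rw [Nat.cast_zero]
      refine Finset.prod_eq_zero (Finset.mem_univ i) ?_
      simp at hi hmem
      simp [hi, hmem]

/-- Minsky–Papert symmetrization.  Every real `n`-variate polynomial `p`
of degree at most `T` has a univariate companion `q` of degree at most `T` such that
`q(k)` is the average of `p` over all Boolean points of Hamming weight `k`. -/
theorem symmetrization (n T : ℕ) (p : MvPolynomial (Fin n) ℝ)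
    (hdeg : p.totalDegree ≤ T) :
    ∃ q : Polynomial ℝ, q.natDegree ≤ T ∧
      ∀ k : ℕ, k ≤ n →
        q.eval (k : ℝ) =
          (1 / (n.choose k : ℝ)) *
            ∑ x ∈ Finset.univ.filter
                (fun x : Fin n → Bool => (Finset.univ.filter fun i => x i).card = k),
              MvPolynomial.eval (fun i => if x i then (1 : ℝ) else 0) p := by
  refine ⟨∑ d ∈ p.support, Polynomial.C (p.coeff d / (n.descFactorial d.support.card : ℝ)) *
    descPochhammer ℝ d.support.card, ?_, ?_⟩
  · refine Polynomial.natDegree_sum_le_of_forall_le _ _ fun d hd => ?_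
    refine (Polynomial.natDegree_C_mul_le _ _).trans ?_
    rw [descPochhammer_natDegree]
    refine le_trans ?_ ((MvPolynomial.le_totalDegree hd).trans hdeg)
    rw [Finset.card_eq_sum_ones]
    exact Finset.sum_le_sum fun i hi =>
      Nat.one_le_iff_ne_zero.mpr (Finsupp.mem_support_iff.mp hi)
  · intro k hk
    simp only [MvPolynomial.eval_eq']
    rw [Finset.sum_comm, Polynomial.eval_finsetSum, Finset.mul_sum]
    refine Finset.sum_congr rfl fun d _ => ?_
    rw [← Finset.mul_sum, symm_sum, Polynomial.eval_mul, Polynomial.eval_C,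
      descPochhammer_eval_eq_descFactorial, Nat.descFactorial_eq_factorial_mul_choose,
      Nat.descFactorial_eq_factorial_mul_choose]
    have hc : (n.choose k : ℝ) ≠ 0 := by exact_mod_cast (Nat.choose_pos hk).ne'
    have hs : d.support.card ≤ n := by simpa using Finset.card_le_univ d.support
    have hcs : (n.choose d.support.card : ℝ) ≠ 0 := by exact_mod_cast (Nat.choose_pos hs).ne'
    have hf : (d.support.card.factorial : ℝ) ≠ 0 := by
      exact_mod_cast Nat.factorial_ne_zero _
    have key : (n.choose k : ℝ) * k.choose d.support.card = n.choose d.support.card *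
        (((Finset.univ : Finset (Fin n)).powersetCard k).filter (d.support ⊆ ·)).card := by
      exact_mod_cast symm_count n k d.support
    push_cast
    field_simp
    linear_combination p.coeff d * key
end

section
/- Let n ≥ 4 be an integer and let q be a univariate real polynomial such that q(t) ≥ 0 for all t ∈ [0,n], q(0) ≥ 1/2, and q(k) ≤ 1/6 for every integer k with 4 ≤ k ≤ n. Then the degree of q is at least √(n/12). -/
open Polynomial in
theorem markov_aux_endpoint (P : ℝ[X]) (d : ℕ) (hd : P.natDegree ≤ d) (M a b : ℝ) (hM : 0 < M)
    (h : ∀ s ∈ Set.Icc (-1 : ℝ) 1, 0 ≤ P.eval ((b - a) / 2 * s + (a + b) / 2) ∧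
      P.eval ((b - a) / 2 * s + (a + b) / 2) ≤ M) :
    (b - a) * P.derivative.eval b ≤ M * (d : ℝ) ^ 2 := by
  have key := Polynomial.Chebyshev.eval_iterate_derivative_le_of_forall_abs_le_one (n := d)
    (P := C (2 / M) * ((P - C (M / 2)).comp (C ((b - a) / 2) * X + C ((a + b) / 2))))
    (k := 1) (x := 1) le_rfl ?_ ?_
  · have hT : (derivative (Chebyshev.T ℝ d)).eval 1 = (d : ℝ) ^ 2 := by
      rw [Polynomial.Chebyshev.T_derivative_eq_U]
      simp [Polynomial.Chebyshev.U_eval_one]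
      ring
    simp only [Function.iterate_one] at key
    rw [hT] at key
    have e : (b - a) / 2 + (a + b) / 2 = b := by ring
    simp [derivative_comp, e] at key
    have : 2 / M * ((b - a) / 2 * P.derivative.eval b)
      = (b - a) * P.derivative.eval b / M := by ring
    rw [this, div_le_iff₀ hM] at key
    linarith
  · apply degree_le_of_natDegree_le
    refine (natDegree_C_mul_le _ _).trans (natDegree_comp_le.trans ?_)
    have h1 : (P - C (M / 2)).natDegree ≤ d := by
      rw [natDegree_sub_C]; exact hd
    have h2 : (C ((b - a) / 2) * X + C ((a + b) / 2)).natDegree ≤ 1 := natDegree_linear_le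
    calc _ ≤ d * 1 := Nat.mul_le_mul h1 h2
      _ = d := mul_one d
  · intro s hs
    obtain ⟨h1, h2⟩ := h s hs
    simp only [eval_mul, eval_C, eval_comp, eval_sub, eval_add, eval_X]
    rw [abs_le]
    constructor
    · rw [div_mul_eq_mul_div, le_div_iff₀ hM]; linarith
    · rw [div_mul_eq_mul_div, div_le_iff₀ hM]; linarith

open Polynomial in
theorem markov_aux_endpoint_abs (P : ℝ[X]) (M a b : ℝ) (hM : 0 < M)
    (h : ∀ s ∈ Set.Icc (-1 : ℝ) 1, 0 ≤ P.eval ((b - a) / 2 * s + (a + b) / 2) ∧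
      P.eval ((b - a) / 2 * s + (a + b) / 2) ≤ M) :
    |b - a| * |P.derivative.eval b| ≤ M * (P.natDegree : ℝ) ^ 2 := by
  have h1 := markov_aux_endpoint P _ le_rfl M a b hM h
  have h2 := markov_aux_endpoint (C M - P) P.natDegree
    ((natDegree_sub_le _ _).trans (by simp)) M a b hM (by
      intro s hs
      obtain ⟨u, v⟩ := h s hs
      simp only [eval_sub, eval_C]
      constructor <;> linarith)
  simp at h2
  rw [← abs_mul, abs_le]
  constructor <;> linarith

/-- Markov-type degree lower bound.  If a real univariate polynomial `q`
is nonnegative on `[0,n]`, has `q(0) ≥ 1/2`, and `q(k) ≤ 1/6` for every integer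
`4 ≤ k ≤ n`, then `deg q ≥ √(n/12)`. -/
theorem markov_degree_lower_bound (n : ℕ) (hn : 4 ≤ n) (q : Polynomial ℝ)
    (hnonneg : ∀ t ∈ Set.Icc (0 : ℝ) (n : ℝ), 0 ≤ q.eval t)
    (h0 : (1 : ℝ) / 2 ≤ q.eval 0)
    (hk : ∀ k : ℕ, 4 ≤ k → k ≤ n → q.eval (k : ℝ) ≤ 1 / 6) :
    Real.sqrt ((n : ℝ) / 12) ≤ (q.natDegree : ℝ) := by
  have hn' : (4 : ℝ) ≤ n := by exact_mod_cast hn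
  have hn0 : (0 : ℝ) < n := by linarith
  obtain ⟨t, ht, hmax⟩ := (isCompact_Icc (a := (0 : ℝ)) (b := n)).exists_isMaxOn
    ⟨0, by simp⟩ (f := fun x => q.eval x) q.continuous.continuousOn
  have hmax' : ∀ x ∈ Set.Icc (0 : ℝ) n, q.eval x ≤ q.eval t := fun x hx => hmax hx
  obtain ⟨M, hMdef⟩ : ∃ M, M = q.eval t := ⟨_, rfl⟩
  rw [← hMdef] at hmax'
  have hM : 1 / 2 ≤ M := h0.trans (hmax' 0 ⟨le_rfl, hn0.le⟩)
  have hM0 : 0 < M := by linarith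
  obtain ⟨D, hD⟩ : ∃ D : ℝ, D = (q.natDegree : ℝ) ^ 2 := ⟨_, rfl⟩
  have hD0 : 0 ≤ M * D := by rw [hD]; positivity
  have hder : ∀ x ∈ Set.Icc (0 : ℝ) n, ‖q.derivative.eval x‖ ≤ 2 * M * D / n := by
    intro x hx
    obtain ⟨hx0, hx1⟩ := hx
    rw [Real.norm_eq_abs, le_div_iff₀ hn0]
    rcases le_total (n / 2 : ℝ) x with hc | hc
    · have := markov_aux_endpoint_abs q M 0 x hM0 (by
        rintro s ⟨hs1, hs2⟩
        have hmem : (x - 0) / 2 * s + (0 + x) / 2 ∈ Set.Icc (0 : ℝ) n := by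
          constructor <;> nlinarith
        exact ⟨hnonneg _ hmem, hmax' _ hmem⟩)
      rw [sub_zero, abs_of_nonneg hx0, ← hD] at this
      nlinarith [abs_nonneg (q.derivative.eval x)]
    · have := markov_aux_endpoint_abs q M n x hM0 (by
        rintro s ⟨hs1, hs2⟩
        have hmem : (x - n) / 2 * s + (n + x) / 2 ∈ Set.Icc (0 : ℝ) n := by
          constructor <;> nlinarith
        exact ⟨hnonneg _ hmem, hmax' _ hmem⟩)
      rw [abs_sub_comm, abs_of_nonneg (sub_nonneg.2 hx1), ← hD] at this
      nlinarith [abs_nonneg (q.derivative.eval x)]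
  obtain ⟨k, hk4, hkn, hkt⟩ : ∃ k : ℕ, 4 ≤ k ∧ k ≤ n ∧ |t - k| ≤ 4 := by
    rcases le_total t 4 with hc | hc
    · refine ⟨4, le_rfl, hn, ?_⟩
      rw [abs_le]; constructor <;> push_cast <;> linarith [ht.1]
    · refine ⟨⌊t⌋₊, Nat.le_floor (by exact_mod_cast hc), ?_, ?_⟩
      · exact Nat.floor_le_of_le ht.2
      · have h1 := Nat.floor_le ht.1
        have h2 := Nat.lt_floor_add_one t
        rw [abs_le]; constructor <;> linarith
  have hkmem : (k : ℝ) ∈ Set.Icc (0 : ℝ) n := ⟨by positivity, by exact_mod_cast hkn⟩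
  have hlip := (convex_Icc (0 : ℝ) n).norm_image_sub_le_of_norm_hasDerivWithin_le
    (f := fun x => q.eval x) (f' := fun x => q.derivative.eval x)
    (fun x _ => (q.hasDerivAt x).hasDerivWithinAt) hder hkmem ht
  have h6 := hk k hk4 hkn
  simp only [Real.norm_eq_abs, ← hMdef] at hlip
  have h7 : 2 / 3 * M ≤ 2 * M * D / n * 4 :=
    calc 2 / 3 * M ≤ |M - q.eval (k : ℝ)| := by
          refine le_trans ?_ (le_abs_self _); linarith
      _ ≤ _ := hlip
      _ ≤ _ := by gcongr; apply div_nonneg <;> linarith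
  rw [div_mul_eq_mul_div (2 * M * D), le_div_iff₀ hn0] at h7
  have h8 : (n : ℝ) ≤ 12 * D := by
    have : M * n ≤ M * (12 * D) := by linarith
    exact le_of_mul_le_mul_left this hM0
  apply Real.sqrt_le_iff.2
  exact ⟨by positivity, by rw [← hD]; linarith⟩
end

section
/- Let n ≥ 1 and let M be the 2^n × 2^n matrix with rows and columns indexed by x, y ∈ {0,1}^n and entries M(x,y) = (|x∧y| - 1)^2. Then rk_psd(M) ≥ n/√2. -/
/-- A psd factorization of size `d` of a matrix `M`. -/
def PsdFactorization {X Y : Type} (M : Matrix X Y ℝ) (d : ℕ) : Prop :=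
  ∃ (A : X → Matrix (Fin d) (Fin d) ℝ) (B : Y → Matrix (Fin d) (Fin d) ℝ),
    (∀ x, (A x).PosSemidef) ∧ (∀ y, (B y).PosSemidef) ∧
    ∀ x y, M x y = Matrix.trace (A x * B y)

/-- The psd rank of a matrix. -/
noncomputable def psdRank {X Y : Type} (M : Matrix X Y ℝ) : ℕ :=
  sInf {d | PsdFactorization M d}

/-- Indicator of `{i, j}`. -/
def pairVec {n : ℕ} (i j : Fin n) : Fin n → Bool := fun t => decide (t = i ∨ t = j)

/-- Real indicator. -/
def bR (b : Bool) : ℝ := if b then 1 else 0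

lemma card_pair {n : ℕ} (i j : Fin n) (y : Fin n → Bool) :
    ((Finset.univ.filter fun t => pairVec i j t ∧ y t).card : ℝ)
      = if i = j then bR (y i) else bR (y i) + bR (y j) := by
  have h1 : ((Finset.univ.filter fun t => pairVec i j t ∧ y t).card : ℝ)
      = ∑ t ∈ ({i, j} : Finset (Fin n)), bR (y t) := by
    have : (Finset.univ.filter fun t => pairVec i j t ∧ y t)
        = ({i, j} : Finset (Fin n)).filter (fun t => y t) := by
      ext t; simp [pairVec]
    rw [this, Finset.card_filter]
    push_cast
    rfl
  rw [h1]
  split_ifs with h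
  · subst h; simp
  · rw [Finset.sum_pair h]

/-- The entries of the matrix. -/
noncomputable def ent {n : ℕ} (x y : Fin n → Bool) : ℝ :=
  (((Finset.univ.filter fun i => x i ∧ y i).card : ℝ) - 1) ^ 2

lemma ent_zero {n : ℕ} (y : Fin n → Bool) : ent (fun _ => false) y = 1 := by
  simp [ent]

lemma ent_pair {n : ℕ} (i j : Fin n) (y : Fin n → Bool) : ent (pairVec i j) y =
    ((if i = j then bR (y i) else bR (y i) + bR (y j)) - 1) ^ 2 := by
  rw [ent, card_pair]

/-- Second difference in the row. -/
lemma ent_diff {n : ℕ} (i j : Fin n) (y : Fin n → Bool) :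
    ent (pairVec i j) y - ent (pairVec i i) y - ent (pairVec j j) y + ent (fun _ => false) y
     = (if i = j then 1 else 2) * (bR (y i) * bR (y j)) := by
  simp only [ent_pair, ent_zero]
  split_ifs with h
  · subst h
    cases y i <;> simp [bR]
  · ring

lemma bdiff {n : ℕ} (i j k l : Fin n) (h : i ≤ j) (h' : k ≤ l) :
    (bR (pairVec k l i) * bR (pairVec k l j) - bR (pairVec k k i) * bR (pairVec k k j)
      - bR (pairVec l l i) * bR (pairVec l l j) + 0 : ℝ)
     = if (i = k ∧ j = l) then (if i = j then -1 else 1) else 0 := by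
  simp only [bR, pairVec, or_self, decide_eq_true_eq]
  grind

lemma card_idx (n : ℕ) : n * n ≤ 2 * Fintype.card {p : Fin n × Fin n // p.1 ≤ p.2} := by
  rw [Fintype.card_subtype]
  set S := (Finset.univ.filter fun p : Fin n × Fin n => p.1 ≤ p.2)
  have h : (Finset.univ : Finset (Fin n × Fin n)) ⊆ S ∪ S.image Prod.swap := by
    rintro ⟨a, b⟩ -
    rcases le_total a b with h | h
    · simp [S, h]
    · simp [S, h]
  have h2 := (Finset.card_le_card h).trans (Finset.card_union_le _ _)
  have h3 : (S.image Prod.swap).card ≤ S.card := Finset.card_image_le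
  simp only [Finset.card_univ, Fintype.card_prod, Fintype.card_fin] at h2
  omega

lemma bound {n d : ℕ} (A B : (Fin n → Bool) → Matrix (Fin d) (Fin d) ℝ)
    (h : ∀ x y, ent x y = Matrix.trace (A x * B y)) : n * n ≤ 2 * (d * d) := by
  let D (C : (Fin n → Bool) → Matrix (Fin d) (Fin d) ℝ) (p : Fin n × Fin n) :=
    C (pairVec p.1 p.2) - C (pairVec p.1 p.1) - C (pairVec p.2 p.2) + C (fun _ => false)
  have key : ∀ p q : {p : Fin n × Fin n // p.1 ≤ p.2},
      Matrix.trace (D A p * D B q) =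
        if p = q then (if p.1.1 = p.1.2 then -1 else 2) else 0 := by
    rintro ⟨⟨i, j⟩, hij⟩ ⟨⟨k, l⟩, hkl⟩
    have e : ∀ y, Matrix.trace (D A (i, j) * B y) =
        (if i = j then 1 else 2) * (bR (y i) * bR (y j)) := by
      intro y
      rw [← ent_diff]
      simp only [D, add_mul, sub_mul, Matrix.trace_add, Matrix.trace_sub, h]
    have hb := bdiff i j k l hij hkl
    have : Matrix.trace (D A (i, j) * D B (k, l)) = (if i = j then 1 else 2) *
      (bR (pairVec k l i) * bR (pairVec k l j) - bR (pairVec k k i) * bR (pairVec k k j)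
      - bR (pairVec l l i) * bR (pairVec l l j) + 0) := by
      have e' : D B (k, l) = B (pairVec k l) - B (pairVec k k) - B (pairVec l l)
        + B (fun _ => false) := rfl
      rw [e']
      simp only [mul_add, mul_sub, Matrix.trace_add, Matrix.trace_sub, e]
      simp [bR]
    simp only [Subtype.mk.injEq, Prod.mk.injEq]
    rw [this, hb]
    split_ifs <;> norm_num
  have li : LinearIndependent ℝ
      (fun p : {p : Fin n × Fin n // p.1 ≤ p.2} => D A p) := by
    rw [Fintype.linearIndependent_iff]
    intro g hg q
    have := congrArg (fun X => Matrix.trace (X * D B q)) hg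
    simp only [Finset.sum_mul, Matrix.trace_sum, Matrix.smul_mul, Matrix.trace_smul, key,
      zero_mul, Matrix.trace_zero, smul_eq_mul, mul_ite, mul_zero, Finset.sum_ite_eq',
      Finset.mem_univ, if_true] at this
    split_ifs at this <;> linarith
  have hc := li.fintype_card_le_finrank
  rw [Module.finrank_matrix] at hc
  simp only [Fintype.card_fin, Module.finrank_self, mul_one] at hc
  have := card_idx n
  omega

lemma exists_fact {n : ℕ} (M : Matrix (Fin n → Bool) (Fin n → Bool) ℝ)
    (hM : ∀ x y, 0 ≤ M x y) : ∃ d, PsdFactorization M d := by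
  let e := Fintype.equivFin (Fin n → Bool)
  refine ⟨_, fun x => Matrix.diagonal (fun k => M x (e.symm k)),
    fun y => Matrix.diagonal (fun k => if k = e y then 1 else 0), ?_, ?_, ?_⟩
  · intro x
    exact Matrix.PosSemidef.diagonal (fun k => hM _ _)
  · intro y
    refine Matrix.PosSemidef.diagonal (fun k => ?_)
    dsimp only [Pi.zero_apply]
    split_ifs <;> norm_num
  · intro x y
    simp [Matrix.diagonal_mul_diagonal, Matrix.trace_diagonal]

/-- The `2ⁿ × 2ⁿ` matrix `M(x,y) = (|x∧y| - 1)²` has psd rank at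
least `n/√2`. -/
theorem psdRank_lower_bound (n : ℕ) (hn : 1 ≤ n)
    (M : Matrix (Fin n → Bool) (Fin n → Bool) ℝ)
    (hM : ∀ x y, M x y =
      (((Finset.univ.filter fun i => x i ∧ y i).card : ℝ) - 1) ^ 2) :
    (n : ℝ) / Real.sqrt 2 ≤ (psdRank M : ℝ) := by
  have hne : ∃ d, PsdFactorization M d :=
    exists_fact M (fun x y => by rw [hM]; positivity)
  obtain ⟨A, B, -, -, hAB⟩ : PsdFactorization M (psdRank M) := Nat.sInf_mem hne
  have hb := bound A B (fun x y => by rw [← hAB, hM, ent])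
  have hb' : (n : ℝ) * n ≤ 2 * ((psdRank M : ℝ) * psdRank M) := by exact_mod_cast hb
  rw [div_le_iff₀ (by positivity)]
  refine (pow_le_pow_iff_left₀ (by positivity) (by positivity) two_ne_zero).1 ?_
  rw [mul_pow, Real.sq_sqrt (by norm_num)]
  nlinarith
end

section
/- Let n ≥ 1, let Y be a finite set, and for every y ∈ Y let f_y : {0,1}^n → ℝ≥0 be a function with deg_sos(f_y) ≤ T. Then the 2^n × |Y| matrix M defined by M(x,y) = f_y(x) satisfies rk_psd(M) ≤ (2n)^{2T}. -/
/-- `f : {0,1}ⁿ → ℝ` has sum-of-squares degree at most `d`: it equals a finite sum of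
squares of `n`-variate real polynomials of degree at most `d` on the Boolean cube. -/
def HasSosDeg (n d : ℕ) (f : (Fin n → Bool) → ℝ) : Prop :=
  ∃ (m : ℕ) (p : Fin m → MvPolynomial (Fin n) ℝ),
    (∀ i, (p i).totalDegree ≤ d) ∧
    ∀ x, f x = ∑ i, (MvPolynomial.eval (fun j => if x j then (1 : ℝ) else 0) (p i)) ^ 2

/-- Evaluation of a product of `T` factors, each a variable or `1`. -/
def sosVec {n : ℕ} (T : ℕ) (z : Fin n → ℝ) (g : Fin T → Option (Fin n)) : ℝ :=
  ∏ t, (g t).elim 1 z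

theorem sosVec_multiset {n : ℕ} (T : ℕ) : ∀ s : Multiset (Fin n), s.card ≤ T →
    ∃ g : Fin T → Option (Fin n), ∀ z : Fin n → ℝ, (s.map z).prod = sosVec T z g := by
  induction T with
  | zero =>
    intro s hs
    have : s = 0 := by simpa using hs
    subst this
    exact ⟨fun _ => none, fun z => by simp [sosVec]⟩
  | succ T ih =>
    intro s
    induction s using Multiset.induction with
    | empty => intro _; exact ⟨fun _ => none, fun z => by simp [sosVec]⟩
    | cons a s _ =>
      intro hs
      obtain ⟨g, hg⟩ := ih s (by simpa using hs)
      refine ⟨Fin.cons (some a) g, fun z => ?_⟩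
      simp [sosVec, Fin.prod_univ_succ, hg z]

theorem sosVec_poly {n : ℕ} (T : ℕ) (p : MvPolynomial (Fin n) ℝ) (hp : p.totalDegree ≤ T) :
    ∃ c : (Fin T → Option (Fin n)) → ℝ, ∀ z : Fin n → ℝ,
      MvPolynomial.eval z p = ∑ g, sosVec T z g * c g := by
  classical
  have h : ∀ m : Fin n →₀ ℕ, ∃ g : Fin T → Option (Fin n), m ∈ p.support →
      ∀ z : Fin n → ℝ, ∏ i, z i ^ m i = sosVec T z g := by
    intro m
    by_cases hm : m ∈ p.support
    · obtain ⟨g, hg⟩ := sosVec_multiset T m.toMultiset (by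
        rw [Finsupp.card_toMultiset]
        exact (MvPolynomial.le_totalDegree hm).trans hp)
      refine ⟨g, fun _ z => ?_⟩
      rw [← hg z, Finsupp.toMultiset_map, Finsupp.prod_toMultiset,
        Finsupp.prod_mapDomain_index (by simp) (by intros; simp [pow_add]),
        Finsupp.prod_fintype _ _ (by simp)]
    · exact ⟨fun _ => none, fun h => absurd h hm⟩
  choose G hG using h
  refine ⟨fun g => ∑ m ∈ p.support, if G m = g then p.coeff m else 0, fun z => ?_⟩
  rw [MvPolynomial.eval_eq']
  simp_rw [Finset.mul_sum]
  rw [Finset.sum_comm]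
  refine Finset.sum_congr rfl fun m hm => ?_
  rw [hG m hm z]
  simp [mul_comm]

/-- If every `f_y : {0,1}ⁿ → ℝ≥0` has sos degree at most `T`, then the
matrix `M(x,y) = f_y(x)` has psd rank at most `(2n)^{2T}`. -/
theorem psdRank_upper_bound_from_sos (n T : ℕ) (hn : 1 ≤ n) {Y : Type} [Fintype Y]
    (f : Y → (Fin n → Bool) → ℝ) (hf0 : ∀ y x, 0 ≤ f y x)
    (hsos : ∀ y, HasSosDeg n T (f y))
    (M : Matrix (Fin n → Bool) Y ℝ) (hM : ∀ x y, M x y = f y x) :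
    psdRank M ≤ (2 * n) ^ (2 * T) := by
  classical
  have hcard : Fintype.card (Fin T → Option (Fin n)) = (n + 1) ^ T := by simp
  have hle : (n + 1) ^ T ≤ (2 * n) ^ (2 * T) :=
    (Nat.pow_le_pow_left (by omega) T).trans (Nat.pow_le_pow_right (by omega) (by omega))
  refine le_trans (Nat.sInf_le ?_) hle
  let e : Fin ((n + 1) ^ T) ≃ (Fin T → Option (Fin n)) := (Fintype.equivFinOfCardEq hcard).symm
  choose m p hp hfp using hsos
  choose c hc using fun y i => sosVec_poly T (p y i) (hp y i)
  let v : (Fin n → Bool) → Fin ((n + 1) ^ T) → ℝ := fun x k =>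
    sosVec T (fun j => if x j then (1 : ℝ) else 0) (e k)
  let w : (y : Y) → Fin (m y) → Fin ((n + 1) ^ T) → ℝ := fun y i k => c y i (e k)
  refine ⟨fun x => Matrix.vecMulVec (v x) (v x),
    fun y => ∑ i, Matrix.vecMulVec (w y i) (w y i), fun x => ?_, fun y => ?_, fun x y => ?_⟩
  · simpa using Matrix.posSemidef_vecMulVec_self_star (v x)
  · exact Matrix.posSemidef_sum _ fun i _ => by
      simpa using Matrix.posSemidef_vecMulVec_self_star (w y i)
  · rw [hM, hfp, Finset.mul_sum, Matrix.trace_sum]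
    refine Finset.sum_congr rfl fun i _ => ?_
    rw [hc y i, ← e.sum_comp, Matrix.vecMulVec_mul_vecMulVec, Matrix.trace_vecMulVec,
      dotProduct_smul, sq]
    rfl
end

section
/- Let n ≥ 1 and let f : {0,1}^n → ℝ≥0 be defined by f(x) = (x_1+...+x_n - 1)^2. Then ldeg_+(f) = n; in particular, any nonnegative literal polynomial that agrees with f on {0,1}^n must contain, with nonzero coefficient, a product involving all n variables. -/
/-- The Boolean point `x ∈ {0,1}ⁿ` viewed as a real vector. -/
def b2r {n : ℕ} (x : Fin n → Bool) : Fin n → ℝ := fun i => if x i then 1 else 0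

/-- `f : {0,1}ⁿ → ℝ` agrees on the Boolean cube with a nonnegative literal polynomial of
degree at most `d`: a nonnegative combination of products of literals `x_i` or `1 - x_i`,
with each product whose coefficient is nonzero involving at most `d` variables. -/
def HasLitDeg (n d : ℕ) (f : (Fin n → Bool) → ℝ) : Prop :=
  ∃ (m : ℕ) (α : Fin m → ℝ) (S : Fin m → Finset (Fin n)) (b : Fin m → Fin n → Bool),
    (∀ j, 0 ≤ α j) ∧ (∀ j, α j ≠ 0 → (S j).card ≤ d) ∧
    ∀ x, f x = ∑ j, α j * ∏ i ∈ S j, (if b j i then b2r x i else 1 - b2r x i)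

/-- The nonnegative literal degree `ldeg₊(f)`. -/
noncomputable def ldegPos (n : ℕ) (f : (Fin n → Bool) → ℝ) : ℕ :=
  sInf {d | HasLitDeg n d f}

theorem lit_eq {n : ℕ} (x : Fin n → Bool) (c : Bool) (i : Fin n) :
    (if c then b2r x i else 1 - b2r x i) = if c = x i then (1 : ℝ) else 0 := by
  unfold b2r
  cases c <;> cases x i <;> simp

theorem prod_lit_eq {n : ℕ} (x b : Fin n → Bool) (S : Finset (Fin n)) :
    (∏ i ∈ S, (if b i then b2r x i else 1 - b2r x i)) =
      if ∀ i ∈ S, b i = x i then (1 : ℝ) else 0 := by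
  rw [Finset.prod_congr rfl (fun i _ => lit_eq x (b i) i)]
  exact Finset.prod_ite_zero.trans (by simp)

theorem hasLitDeg_full (n : ℕ) (f : (Fin n → Bool) → ℝ) (h0 : ∀ x, 0 ≤ f x) :
    HasLitDeg n n f := by
  let e := Fintype.equivFin (Fin n → Bool)
  refine ⟨_, fun j => f (e.symm j), fun _ => Finset.univ, fun j => e.symm j,
    fun j => h0 _, fun j _ => by simp, fun x => ?_⟩
  simp only [prod_lit_eq]
  rw [Equiv.sum_comp e.symm
    (fun y => f y * if ∀ i ∈ Finset.univ, y i = x i then (1 : ℝ) else 0)]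
  rw [Finset.sum_eq_single x]
  · simp
  · intro y _ hy
    rw [if_neg, mul_zero]
    intro h
    exact hy (funext fun i => h i (Finset.mem_univ i))
  · simp

/-- The function `f(x) = (|x| - 1)²` has nonnegative literal degree
exactly `n`. -/
theorem ldegPos_of_weight_minus_one_sq (n : ℕ) (hn : 1 ≤ n)
    (f : (Fin n → Bool) → ℝ)
    (hf : ∀ x, f x = ((∑ i, b2r x i) - 1) ^ 2) :
    ldegPos n f = n := by
  have hfull : HasLitDeg n n f :=
    hasLitDeg_full n f (fun x => by rw [hf]; positivity)
  apply le_antisymm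
  · exact Nat.sInf_le hfull
  · apply le_csInf ⟨n, hfull⟩
    rintro d ⟨m, α, S, b, hα, hd, hx⟩
    simp only [prod_lit_eq] at hx
    have h0 := hx (fun _ => false)
    rw [hf] at h0
    have h1 : (∑ j, α j * if ∀ i ∈ S j, b j i = false then (1 : ℝ) else 0) ≠ 0 := by
      rw [← h0]; simp [b2r]
    obtain ⟨j, -, hj⟩ := Finset.exists_ne_zero_of_sum_ne_zero h1
    have hαj : α j ≠ 0 := left_ne_zero_of_mul hj
    have hb : ∀ i ∈ S j, b j i = false := by
      by_contra h
      exact hj (by rw [if_neg h, mul_zero])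
    have hS : S j = Finset.univ := by
      by_contra hne
      obtain ⟨k, hk⟩ : ∃ k, k ∉ S j := by
        by_contra! h
        exact hne (Finset.eq_univ_iff_forall.2 h)
      have h2 := hx (fun i => decide (i = k))
      rw [hf] at h2
      have h3 : ((∑ i, b2r (fun i => decide (i = k)) i) - 1) ^ 2 = (0 : ℝ) := by
        simp [b2r]
      rw [h3] at h2
      have h4 := (Finset.sum_eq_zero_iff_of_nonneg (fun j _ =>
        mul_nonneg (hα j) (by split_ifs <;> norm_num))).1 h2.symm j (Finset.mem_univ j)
      rw [if_pos, mul_one] at h4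
      · exact hαj h4
      · intro i hi
        rw [hb i hi]
        have : i ≠ k := fun h => hk (h ▸ hi)
        simp [this]
    have := hd j hαj
    rw [hS] at this
    simpa using this
end

section
/- For every ε > 0 there exists a constant C > 0 such that for every even integer n ≥ 2 the following holds. Let S be the nonnegative matrix whose rows are indexed by odd-cardinality subsets U ⊆ {1,...,n}, whose columns are indexed by perfect matchings M of the complete graph K_n, and whose entries are S(U,M) = |δ(U) ∩ M| - 1, where δ(U) ∩ M is the set of edges of M with exactly one endpoint in U. Then there exists a nonnegative matrix S̃ with the same index sets such that rk_psd(S̃) ≤ 2^{C · n^{1/2+ε} · (log n)^2}, and for every entry (U,M): if |δ(U) ∩ M| > (n/2)^{2ε} then S(U,M) - 2^{-(n/2)^{2ε}} ≤ S̃(U,M) ≤ S(U,M), and otherwise S̃(U,M) = S(U,M). -/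
/-- A perfect matching of the complete graph `K_n`, encoded as a fixed-point-free
involution of the vertex set. -/
def IsPM {n : ℕ} (π : Equiv.Perm (Fin n)) : Prop :=
  (∀ i, π (π i) = i) ∧ ∀ i, π i ≠ i

/-- `|δ(U) ∩ M|`: the number of edges of the matching (given by the involution `π`)
crossing the cut induced by `U`. -/
def cutCard {n : ℕ} (U : Finset (Fin n)) (π : Equiv.Perm (Fin n)) : ℕ :=
  (U.filter fun i => π i ∉ U).card
open Polynomial

theorem psdFact_of_fintype {X Y : Type} (M : Matrix X Y ℝ) {ι : Type} [Fintype ι]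
    (A : X → Matrix ι ι ℝ) (B : Y → Matrix ι ι ℝ)
    (hA : ∀ x, (A x).PosSemidef) (hB : ∀ y, (B y).PosSemidef)
    (h : ∀ x y, M x y = Matrix.trace (A x * B y)) : PsdFactorization M (Fintype.card ι) := by
  let e := (Fintype.equivFin ι).symm
  refine ⟨fun x => (A x).submatrix e e, fun y => (B y).submatrix e e,
    fun x => (hA x).submatrix _, fun y => (hB y).submatrix _, fun x y => ?_⟩
  rw [h, Matrix.submatrix_mul_equiv, Matrix.trace, Matrix.trace]
  exact (Equiv.sum_comp e fun i => (A x * B y) i i).symm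

theorem psdFact_mul {X Y : Type} {M M' : Matrix X Y ℝ} {d d' : ℕ}
    (h : PsdFactorization M d) (h' : PsdFactorization M' d') :
    PsdFactorization (Matrix.of fun x y => M x y * M' x y) (d * d') := by
  obtain ⟨A, B, hA, hB, hM⟩ := h
  obtain ⟨A', B', hA', hB', hM'⟩ := h'
  have := psdFact_of_fintype (Matrix.of fun x y => M x y * M' x y)
    (fun x => Matrix.kronecker (A x) (A' x)) (fun y => Matrix.kronecker (B y) (B' y))
    (fun x => (hA x).kronecker (hA' x)) (fun y => (hB y).kronecker (hB' y)) (fun x y => by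
      show M x y * M' x y = _
      rw [hM, hM', ← Matrix.trace_kronecker, Matrix.mul_kronecker_mul]; rfl)
  simpa using this

theorem psdFact_const {X Y : Type} (c : ℝ) (hc : 0 ≤ c) :
    PsdFactorization (Matrix.of fun (_ : X) (_ : Y) => c) 1 := by
  refine ⟨fun _ => Matrix.diagonal fun _ => c, fun _ => 1, fun _ => ?_, fun _ => Matrix.PosSemidef.one,
    fun x y => ?_⟩
  · exact Matrix.posSemidef_diagonal_iff.2 fun _ => hc
  · simp [Matrix.trace]

/-- row vector -/
noncomputable def rowVec {n : ℕ} (U : Finset (Fin n)) (a b : ℝ) (q : Fin n × Fin n) : ℝ :=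
  a * (if q.1 ∈ U ∧ q.2 ∉ U then 1 else 0) + b / n

noncomputable def colVec {n : ℕ} (π : Equiv.Perm (Fin n)) (q : Fin n × Fin n) : ℝ :=
  if π q.1 = q.2 then 1 else 0

theorem vec_sum {n : ℕ} (hn : 0 < n) (U : Finset (Fin n)) (π : Equiv.Perm (Fin n)) (a b : ℝ) :
    ∑ q, rowVec U a b q * colVec π q = a * (cutCard U π : ℝ) + b := by
  have hn' : (n : ℝ) ≠ 0 := by positivity
  rw [Fintype.sum_prod_type]
  simp only [rowVec, colVec, mul_ite, mul_one, mul_zero, Finset.sum_ite_eq, Finset.mem_univ, if_true]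
  rw [Finset.sum_add_distrib]
  congr 1
  · rw [← Finset.sum_filter, Finset.sum_const, cutCard, nsmul_eq_mul, mul_comm]
    congr 3
    ext i; simp
  · simp; field_simp

theorem psdFact_affine {n : ℕ} (hn : 0 < n) (a b : ℝ) (h0 : 0 ≤ b) (h1 : 0 ≤ a * n + b) :
    PsdFactorization (Matrix.of fun (U : {U : Finset (Fin n) // Odd U.card})
      (π : {π : Equiv.Perm (Fin n) // IsPM π}) => a * (cutCard U.1 π.1 : ℝ) + b) (n * n) := by
  have := psdFact_of_fintype (Matrix.of fun (U : {U : Finset (Fin n) // Odd U.card})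
      (π : {π : Equiv.Perm (Fin n) // IsPM π}) => a * (cutCard U.1 π.1 : ℝ) + b)
    (fun U => Matrix.diagonal (rowVec U.1 a b)) (fun π => Matrix.diagonal (colVec π.1))
    (fun U => Matrix.posSemidef_diagonal_iff.2 fun q => ?_)
    (fun π => Matrix.posSemidef_diagonal_iff.2 fun q => ?_) (fun U π => ?_)
  · simpa using this
  · have hn' : (0 : ℝ) < n := by positivity
    unfold rowVec
    split_ifs
    · have : a * 1 + b / n = (a * n + b) / n := by field_simp
      rw [this]; positivity
    · have : 0 ≤ b / n := by positivity
      simpa using this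
  · unfold colVec; split_ifs <;> norm_num
  · rw [Matrix.diagonal_mul_diagonal, Matrix.trace_diagonal, vec_sum hn]; rfl

theorem psdFact_quad {n : ℕ} (hn : 0 < n) (r s : ℝ) :
    PsdFactorization (Matrix.of fun (U : {U : Finset (Fin n) // Odd U.card})
      (π : {π : Equiv.Perm (Fin n) // IsPM π}) => ((cutCard U.1 π.1 : ℝ) - r) ^ 2 + s ^ 2)
      (n * n) := by
  have := psdFact_of_fintype (Matrix.of fun (U : {U : Finset (Fin n) // Odd U.card})
      (π : {π : Equiv.Perm (Fin n) // IsPM π}) => ((cutCard U.1 π.1 : ℝ) - r) ^ 2 + s ^ 2)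
    (fun U => Matrix.vecMulVec (rowVec U.1 1 (-r)) (star (rowVec U.1 1 (-r)))
       + Matrix.diagonal (rowVec U.1 0 (s ^ 2)))
    (fun π => Matrix.vecMulVec (colVec π.1) (star (colVec π.1)))
    (fun U => (Matrix.posSemidef_vecMulVec_self_star _).add
      (Matrix.posSemidef_diagonal_iff.2 fun q => ?_))
    (fun π => Matrix.posSemidef_vecMulVec_self_star _) (fun U π => ?_)
  · simpa using this
  · unfold rowVec; positivity
  · have e1 := vec_sum hn U.1 π.1 1 (-r)
    have e2 := vec_sum hn U.1 π.1 0 (s ^ 2)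
    have hc : ∀ q, colVec π.1 q * colVec π.1 q = colVec π.1 q := by
      intro q; unfold colVec; split_ifs <;> norm_num
    rw [add_mul, Matrix.trace_add]
    have t1 : Matrix.trace (Matrix.vecMulVec (rowVec U.1 1 (-r)) (star (rowVec U.1 1 (-r))) *
        Matrix.vecMulVec (colVec π.1) (star (colVec π.1))) =
        (∑ q, rowVec U.1 1 (-r) q * colVec π.1 q) ^ 2 := by
      rw [sq, Finset.sum_mul_sum]
      simp only [Matrix.trace, Matrix.diag, Matrix.mul_apply, Matrix.vecMulVec_apply, star_trivial]
      refine Finset.sum_congr rfl fun i _ => Finset.sum_congr rfl fun j _ => ?_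
      ring
    have t2 : Matrix.trace (Matrix.diagonal (rowVec U.1 0 (s ^ 2)) *
        Matrix.vecMulVec (colVec π.1) (star (colVec π.1))) =
        (∑ q, rowVec U.1 0 (s ^ 2) q * colVec π.1 q) := by
      simp only [Matrix.trace, Matrix.diag, Matrix.diagonal_mul, Matrix.vecMulVec_apply, star_trivial, hc]
    rw [t1, t2, e1, e2]
    simp only [Matrix.of_apply]
    ring

theorem poly_nonneg_extend {q : ℝ[X]} {a b r : ℝ} (hab : a < b)
    (h : ∀ x ∈ Set.Icc a b, x ≠ r → 0 ≤ q.eval x) : ∀ x ∈ Set.Icc a b, 0 ≤ q.eval x := by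
  intro x hx
  by_contra hneg
  push Not at hneg
  have hcont : ContinuousAt (fun x => q.eval x) x := q.continuous.continuousAt
  have hev := hcont.eventually (gt_mem_nhds hneg)
  obtain ⟨δ, hδ, hball⟩ := Metric.eventually_nhds_iff.1 hev
  have key : ∃ y ∈ Set.Icc a b, dist y x < δ ∧ y ≠ r := by
    by_cases hxr : x = r
    · by_cases hxb : x < b
      · refine ⟨min b (x + δ / 2), ⟨?_, min_le_left _ _⟩, ?_, ?_⟩
        · exact le_min hab.le (by linarith [hx.1])
        · rw [Real.dist_eq, abs_lt]
          constructor
          · have : x < min b (x + δ/2) := lt_min hxb (by linarith)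
            linarith
          · linarith [min_le_right b (x + δ/2)]
        · have : x < min b (x + δ/2) := lt_min hxb (by linarith)
          rw [← hxr]; exact this.ne'
      · have hxa : a < x := by linarith
        have hm : max a (x - δ/2) < x := max_lt hxa (by linarith)
        refine ⟨max a (x - δ / 2), ⟨le_max_left _ _, ?_⟩, ?_, ?_⟩
        · linarith [hx.2]
        · rw [Real.dist_eq, abs_lt]
          constructor
          · linarith [le_max_right a (x - δ/2)]
          · linarith
        · rw [← hxr]; exact hm.ne
    · exact ⟨x, hx, by simpa using hδ, hxr⟩
  obtain ⟨y, hy, hyd, hyr⟩ := key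
  have h1 := h y hy hyr
  have h2 := hball hyd
  linarith

theorem poly_psd {n : ℕ} (hn : 0 < n) : ∀ (D : ℕ) (p : ℝ[X]), p.natDegree = D →
    (∀ x ∈ Set.Icc (0 : ℝ) n, 0 ≤ p.eval x) →
    ∃ d ≤ (n * n) ^ D, PsdFactorization (Matrix.of fun (U : {U : Finset (Fin n) // Odd U.card})
      (π : {π : Equiv.Perm (Fin n) // IsPM π}) => p.eval (cutCard U.1 π.1 : ℝ)) d := by
  have hn' : (0 : ℝ) < n := by positivity
  intro D
  induction D using Nat.strong_induction_on with
  | _ D ih =>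
  intro p hD hp
  by_cases hD0 : D = 0
  · rw [hD0] at hD
    obtain ⟨c, rfl⟩ := natDegree_eq_zero.1 hD
    have hc : 0 ≤ c := by simpa using hp 0 ⟨le_rfl, hn'.le⟩
    refine ⟨1, Nat.one_le_pow _ _ (by positivity), ?_⟩
    simpa using psdFact_const c hc
  have hp0 : p ≠ 0 := by rintro rfl; simp at hD; omega
  -- general step
  have step : ∀ f q : ℝ[X], p = f * q → 0 < f.natDegree →
      (∀ x ∈ Set.Icc (0 : ℝ) n, 0 ≤ q.eval x) →
      PsdFactorization (Matrix.of fun (U : {U : Finset (Fin n) // Odd U.card})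
      (π : {π : Equiv.Perm (Fin n) // IsPM π}) => f.eval (cutCard U.1 π.1 : ℝ)) (n * n) →
      ∃ d ≤ (n * n) ^ D, PsdFactorization (Matrix.of fun (U : {U : Finset (Fin n) // Odd U.card})
      (π : {π : Equiv.Perm (Fin n) // IsPM π}) => p.eval (cutCard U.1 π.1 : ℝ)) d := by
    intro f q hfq hf hq hF
    have hf0 : f ≠ 0 := by rintro rfl; simp at hf
    have hq0 : q ≠ 0 := by rintro rfl; simp at hfq; exact hp0 hfq
    have hdeg : f.natDegree + q.natDegree = D := by rw [← hD, hfq, natDegree_mul hf0 hq0]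
    obtain ⟨d, hd, hfac⟩ := ih q.natDegree (by omega) q rfl hq
    refine ⟨(n * n) * d, ?_, ?_⟩
    · calc (n * n) * d ≤ (n * n) * (n * n) ^ q.natDegree := Nat.mul_le_mul_left _ hd
        _ = (n * n) ^ (q.natDegree + 1) := by ring
        _ ≤ (n * n) ^ D := Nat.pow_le_pow_right (by positivity) (by omega)
    · have := psdFact_mul hF hfac
      simpa [hfq] using this
  obtain ⟨z, hz⟩ := IsAlgClosed.exists_aeval_eq_zero ℂ p (by
    rw [degree_eq_natDegree hp0, hD]; exact_mod_cast hD0)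
  by_cases him : z.im = 0
  · have hroot : p.IsRoot z.re := by
      have hz' : z = ((z.re : ℝ) : ℂ) := by apply Complex.ext <;> simp [him]
      rw [hz'] at hz
      have : (aeval ((z.re : ℝ) : ℂ) p) = ((p.eval z.re : ℝ) : ℂ) := by
        exact aeval_algebraMap_apply_eq_algebraMap_eval (A := ℂ) z.re p
      rw [this] at hz
      exact_mod_cast hz
    generalize z.re = r at hroot
    obtain ⟨q, hq⟩ := dvd_iff_isRoot.2 hroot
    have hev : ∀ x, p.eval x = (x - r) * q.eval x := by intro x; rw [hq]; simp
    rcases le_or_gt r 0 with hr | hr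
    · refine step _ q hq (by simp) ?_ ?_
      · refine poly_nonneg_extend (r := r) hn' fun x hx hxr => ?_
        have h1 := hp x hx
        rw [hev] at h1
        have : 0 < x - r := by
          rcases lt_or_eq_of_le (hr.trans hx.1) with h | h
          · linarith
          · exact absurd h.symm hxr
        exact nonneg_of_mul_nonneg_right h1 this
      · have := psdFact_affine hn 1 (-r) (by linarith) (by linarith)
        simpa [sub_eq_add_neg] using this
    rcases le_or_gt (n : ℝ) r with hr2 | hr2
    · refine step (C r - X) (-q) (by rw [hq]; ring) ?_ ?_ ?_
      · have : (C r - X : ℝ[X]) = -(X - C r) := by ring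
        rw [this, natDegree_neg]; simp
      · refine poly_nonneg_extend (r := r) hn' fun x hx hxr => ?_
        have h1 := hp x hx
        rw [hev] at h1
        have : 0 < r - x := by
          rcases lt_or_eq_of_le (hx.2.trans hr2) with h | h
          · linarith
          · exact absurd h hxr
        have h2 : 0 ≤ (r - x) * (-q).eval x := by simp; linarith
        exact nonneg_of_mul_nonneg_right h2 this
      · have := psdFact_affine hn (-1) r (by linarith) (by linarith)
        have e : ∀ x : ℝ, (C r - X : ℝ[X]).eval x = -1 * x + r := by intro x; simp; ring
        simpa only [e] using this
    · have g1 : 0 ≤ q.eval r := by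
        refine poly_nonneg_extend (a := r) (b := n) (r := r) hr2 (fun x hx hxr => ?_) r ⟨le_rfl, hr2.le⟩
        have h1 := hp x ⟨by linarith [hx.1], hx.2⟩
        rw [hev] at h1
        have : 0 < x - r := by
          have := lt_of_le_of_ne hx.1 (Ne.symm hxr); linarith
        exact nonneg_of_mul_nonneg_right h1 this
      have g2 : 0 ≤ (-q).eval r := by
        refine poly_nonneg_extend (a := 0) (b := r) (r := r) hr (fun x hx hxr => ?_) r ⟨hr.le, le_rfl⟩
        have h1 := hp x ⟨hx.1, by linarith [hx.2]⟩
        rw [hev] at h1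
        have : 0 < r - x := by
          have := lt_of_le_of_ne hx.2 hxr; linarith
        have h2 : 0 ≤ (r - x) * (-q).eval x := by simp; linarith
        exact nonneg_of_mul_nonneg_right h2 this
      have hq0 : q.IsRoot r := by
        simp at g2
        exact le_antisymm g2 g1
      obtain ⟨q2, hq2⟩ := dvd_iff_isRoot.2 hq0
      refine step ((X - C r) ^ 2) q2 (by rw [hq, hq2]; ring) (by simp) ?_ ?_
      · refine poly_nonneg_extend (r := r) hn' fun x hx hxr => ?_
        have h1 := hp x hx
        rw [hev, hq2] at h1
        have : 0 < (x - r) ^ 2 := by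
          have := sub_ne_zero.2 hxr; positivity
        have h2 : 0 ≤ (x - r) ^ 2 * q2.eval x := by simp at h1; linarith
        exact nonneg_of_mul_nonneg_right h2 this
      · have := psdFact_quad hn r 0
        simpa using this
  · obtain ⟨q, hq⟩ := p.quadratic_dvd_of_aeval_eq_zero_im_ne_zero hz him
    have e : ∀ x : ℝ, (X ^ 2 - C (2 * z.re) * X + C (‖z‖ ^ 2) : ℝ[X]).eval x
        = (x - z.re) ^ 2 + z.im ^ 2 := by
      intro x
      rw [← Complex.normSq_eq_norm_sq, Complex.normSq_apply]
      simp; ring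
    refine step _ q hq ?_ ?_ ?_
    · have : (X ^ 2 - C (2 * z.re) * X + C (‖z‖ ^ 2) : ℝ[X]).natDegree = 2 := by compute_degree!
      omega
    · intro x hx
      have h1 := hp x hx
      rw [hq, eval_mul, e] at h1
      exact nonneg_of_mul_nonneg_right h1 (by positivity)
    · simpa only [e] using psdFact_quad hn z.re z.im

theorem cutCard_pos {n : ℕ} (U : Finset (Fin n)) (hU : Odd U.card) (π : Equiv.Perm (Fin n))
    (hπ : IsPM π) : 1 ≤ cutCard U π := by
  by_contra h
  have h0 : cutCard U π = 0 := by omega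
  rw [cutCard, Finset.card_eq_zero, Finset.filter_eq_empty_iff] at h0
  have hs : ∑ i ∈ U, (1 : ZMod 2) = 0 := by
    refine Finset.sum_involution (fun i _ => π i) (fun i _ => by decide) (fun i _ _ => hπ.2 i)
      (fun i hi => by simpa using h0 hi) (fun i _ => hπ.1 i)
  simp at hs
  rw [ZMod.natCast_eq_zero_iff] at hs
  exact (Nat.not_even_iff_odd.2 hU) (even_iff_two_dvd.2 hs)

theorem cutCard_le {n : ℕ} (U : Finset (Fin n)) (π : Equiv.Perm (Fin n)) : cutCard U π ≤ n := by
  calc _ ≤ U.card := Finset.card_filter_le _ _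
    _ ≤ n := by simpa using Finset.card_le_univ U

theorem cheb_mono (d : ℤ) {x y : ℝ} (hx : 1 ≤ x) (hxy : x ≤ y) :
    (Chebyshev.T ℝ d).eval x ≤ (Chebyshev.T ℝ d).eval y := by
  have hy : 1 ≤ y := hx.trans hxy
  rw [← Real.cosh_arcosh hx, ← Real.cosh_arcosh hy, Chebyshev.T_real_cosh, Chebyshev.T_real_cosh,
    Real.cosh_le_cosh, abs_mul, abs_mul]
  refine mul_le_mul_of_nonneg_left ?_ (abs_nonneg _)
  rw [← Real.cosh_le_cosh, Real.cosh_arcosh hx, Real.cosh_arcosh hy]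
  exact hxy

theorem cheb_growth (δ : ℝ) (hδ : 0 ≤ δ) (d : ℕ) :
    1 + (d : ℝ) ^ 2 * δ ≤ (Chebyshev.T ℝ d).eval (1 + δ) := by
  have key : ∀ d : ℕ, 1 + (d : ℝ) ^ 2 * δ ≤ (Chebyshev.T ℝ d).eval (1 + δ) ∧
      (Chebyshev.T ℝ d).eval (1 + δ) + (2 * d + 1) * δ ≤
        (Chebyshev.T ℝ ((d : ℤ) + 1)).eval (1 + δ) := by
    intro d
    induction d with
    | zero => simp
    | succ d ih =>
      obtain ⟨h1, h2⟩ := ih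
      have h3 : 1 ≤ (Chebyshev.T ℝ ((d : ℤ) + 1)).eval (1 + δ) :=
        Chebyshev.one_le_eval_T_real _ (by linarith)
      have h4 : (Chebyshev.T ℝ ((d : ℤ) + 2)).eval (1 + δ) =
          2 * (1 + δ) * (Chebyshev.T ℝ ((d : ℤ) + 1)).eval (1 + δ) -
            (Chebyshev.T ℝ (d : ℤ)).eval (1 + δ) := by
        rw [Chebyshev.T_add_two]; simp
      have h5 : ((d + 1 : ℕ) : ℤ) + 1 = (d : ℤ) + 2 := by push_cast; ring
      rw [h5, h4]
      push_cast
      constructor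
      · nlinarith
      · nlinarith [mul_le_mul_of_nonneg_left h3 hδ]
  exact (key d).1

/-- Polynomials at least 1 on the left of 0 and bounded by 1 on `[0,n]`. -/
def Nice (n : ℝ) (q : ℝ[X]) : Prop :=
  (∀ y ≤ 0, 1 ≤ q.eval y) ∧ ∀ y ∈ Set.Icc 0 n, |q.eval y| ≤ 1

theorem Nice.mul {n : ℝ} {p q : ℝ[X]} (hp : Nice n p) (hq : Nice n q) : Nice n (p * q) := by
  refine ⟨fun y hy => ?_, fun y hy => ?_⟩
  · rw [eval_mul]; exact one_le_mul_of_one_le_of_one_le (hp.1 y hy) (hq.1 y hy)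
  · rw [eval_mul, abs_mul]; exact mul_le_one₀ (hp.2 y hy) (abs_nonneg _) (hq.2 y hy)

theorem Nice.one (n : ℝ) : Nice n 1 := ⟨fun y _ => by simp, fun y _ => by simp⟩

theorem Nice.pow {n : ℝ} {p : ℝ[X]} (hp : Nice n p) (s : ℕ) : Nice n (p ^ s) := by
  induction s with
  | zero => simpa using Nice.one n
  | succ s ih => rw [pow_succ]; exact ih.mul hp

theorem exists_zero_poly (n i : ℝ) (hn : 0 < n) (hi : 0 < i) :
    ∃ c : ℝ[X], Nice n c ∧ c.eval i = 0 ∧ (c.natDegree : ℝ) ≤ √(n / i) + 1 := by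
  set d : ℕ := ⌈√(n / i)⌉₊ with hd
  have hs : 0 < √(n / i) := Real.sqrt_pos.2 (by positivity)
  have hd0 : 0 < d := Nat.ceil_pos.2 hs
  have hd0' : (0 : ℝ) < d := by exact_mod_cast hd0
  have hd1 : √(n / i) ≤ d := Nat.le_ceil _
  have hd2 : n / i ≤ (d : ℝ) ^ 2 := by
    rw [← Real.sq_sqrt (show 0 ≤ n / i by positivity)]; gcongr
  set θ : ℝ := Real.pi / (2 * d) with hθ
  set a : ℝ := (1 - Real.cos θ) / i with ha
  have ha0 : 0 ≤ a := div_nonneg (by linarith [Real.cos_le_one θ]) hi.le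
  have han : a * n ≤ 2 := by
    have h1 := Real.one_sub_sq_div_two_le_cos (x := θ)
    have h2 : θ ^ 2 / 2 * (d : ℝ) ^ 2 ≤ 2 := by
      rw [hθ]; field_simp
      nlinarith [Real.pi_le_four, Real.pi_pos]
    have h3 : a * n = (1 - Real.cos θ) * (n / i) := by rw [ha]; ring
    rw [h3]
    calc (1 - Real.cos θ) * (n / i) ≤ θ ^ 2 / 2 * (d : ℝ) ^ 2 := by
          apply mul_le_mul (by linarith) hd2 (by positivity) (by positivity)
      _ ≤ 2 := h2
  have hev : ∀ y, ((Chebyshev.T ℝ d).comp (1 - C a * X)).eval y =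
      (Chebyshev.T ℝ d).eval (1 - a * y) := by intro y; simp
  refine ⟨(Chebyshev.T ℝ d).comp (1 - C a * X), ⟨fun y hy => ?_, fun y hy => ?_⟩, ?_, ?_⟩
  · rw [hev]; apply Chebyshev.one_le_eval_T_real; nlinarith
  · rw [hev]; apply Chebyshev.abs_eval_T_real_le_one
    rw [abs_le]
    constructor
    · nlinarith [mul_le_mul_of_nonneg_left hy.2 ha0]
    · nlinarith [mul_nonneg ha0 hy.1]
  · have : 1 - a * i = Real.cos θ := by rw [ha]; field_simp; ring
    rw [hev, this, Chebyshev.T_real_cos]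
    have : ((d : ℤ) : ℝ) * θ = Real.pi / 2 := by rw [hθ]; push_cast; field_simp
    rw [this, Real.cos_pi_div_two]
  · have h1 : ((Chebyshev.T ℝ d).comp (1 - C a * X)).natDegree ≤ d := by
      refine natDegree_comp_le.trans ?_
      have h2 : (1 - C a * X : ℝ[X]).natDegree ≤ 1 := by compute_degree
      calc _ ≤ (Chebyshev.T ℝ d).natDegree * 1 := Nat.mul_le_mul_left _ h2
        _ = d := by simp
    calc _ ≤ (d : ℝ) := by exact_mod_cast h1
      _ ≤ _ := (Nat.ceil_lt_add_one hs.le).le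

theorem exists_half_poly (n m : ℝ) (hm : 0 < m) (hmn : m ≤ n) :
    ∃ b : ℝ[X], Nice n b ∧ (∀ y ∈ Set.Icc m n, |b.eval y| ≤ 1 / 2) ∧
      (b.natDegree : ℝ) ≤ √(n / m) + 1 := by
  have hn : 0 < n := by linarith
  set d : ℕ := ⌈√(n / m)⌉₊ with hd
  have hs : 0 < √(n / m) := Real.sqrt_pos.2 (by positivity)
  have hd1 : √(n / m) ≤ d := Nat.le_ceil _
  have hd2 : n / m ≤ (d : ℝ) ^ 2 := by
    rw [← Real.sq_sqrt (show 0 ≤ n / m by positivity)]; gcongr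
  set δ : ℝ := 2 * m / n with hδ
  have hδ0 : 0 ≤ δ := by positivity
  set K : ℝ := (Chebyshev.T ℝ d).eval (1 + δ) with hK
  have hK2 : 2 ≤ K := by
    have h1 := cheb_growth δ hδ0 d
    have h2 : n / m * δ ≤ (d : ℝ) ^ 2 * δ := by gcongr
    have h3 : n / m * δ = 2 := by rw [hδ]; field_simp
    linarith
  have hK0 : 0 < K := by linarith
  set w : ℝ[X] := C (1 + δ) - C (2 / n) * X with hw
  have hev : ∀ y, (C K⁻¹ * (Chebyshev.T ℝ d).comp w).eval y =
      (Chebyshev.T ℝ d).eval (1 + δ - 2 / n * y) / K := by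
    intro y; simp [hw]; field_simp
  have small : ∀ y ∈ Set.Icc m n, |(Chebyshev.T ℝ d).eval (1 + δ - 2 / n * y)| ≤ 1 := by
    intro y hy
    apply Chebyshev.abs_eval_T_real_le_one
    have h1 : 2 / n * y ≤ 2 := by
      rw [div_mul_eq_mul_div, div_le_iff₀ hn]; linarith [hy.2]
    have h2 : δ ≤ 2 / n * y := by
      rw [hδ, div_mul_eq_mul_div]; gcongr; exact hy.1
    rw [abs_le]; constructor <;> linarith
  refine ⟨C K⁻¹ * (Chebyshev.T ℝ d).comp w, ⟨fun y hy => ?_, fun y hy => ?_⟩, fun y hy => ?_, ?_⟩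
  · rw [hev, le_div_iff₀ hK0, one_mul]
    apply cheb_mono _ (by linarith)
    have : 2 / n * y ≤ 0 := mul_nonpos_of_nonneg_of_nonpos (by positivity) hy
    linarith
  · rw [hev, abs_div, abs_of_pos hK0, div_le_one hK0]
    rcases le_total m y with h | h
    · linarith [small y ⟨h, hy.2⟩]
    · have h2 : 2 / n * y ≤ δ := by
        rw [hδ, div_mul_eq_mul_div]; gcongr
      have h3 : 0 ≤ 2 / n * y := mul_nonneg (by positivity) hy.1
      have h4 : 1 ≤ (Chebyshev.T ℝ d).eval (1 + δ - 2 / n * y) :=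
        Chebyshev.one_le_eval_T_real _ (by linarith)
      rw [abs_of_nonneg (by linarith)]
      exact cheb_mono _ (by linarith) (by linarith)
  · rw [hev, abs_div, abs_of_pos hK0, div_le_iff₀ hK0]
    linarith [small y hy]
  · have h1 : (C K⁻¹ * (Chebyshev.T ℝ d).comp w).natDegree ≤ d := by
      refine (natDegree_C_mul_le _ _).trans (natDegree_comp_le.trans ?_)
      have h2 : w.natDegree ≤ 1 := by rw [hw]; compute_degree
      calc _ ≤ (Chebyshev.T ℝ d).natDegree * 1 := Nat.mul_le_mul_left _ h2
        _ = d := by simp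
    calc _ ≤ (d : ℝ) := by exact_mod_cast h1
      _ ≤ _ := (Nat.ceil_lt_add_one hs.le).le

theorem exists_zeros_poly (n : ℝ) (hn : 0 < n) (m : ℕ) :
    ∃ E : ℝ[X], Nice n E ∧ (∀ i : ℕ, 1 ≤ i → i ≤ m → E.eval (i : ℝ) = 0) ∧
      (E.natDegree : ℝ) ≤ 2 * √n * √m + m := by
  induction m with
  | zero => exact ⟨1, Nice.one n, fun i h1 h2 => by omega, by simp⟩
  | succ m ih =>
    obtain ⟨E, hE, hz, hdeg⟩ := ih
    obtain ⟨c, hc, hcz, hcd⟩ := exists_zero_poly n ((m + 1 : ℕ) : ℝ) hn (by positivity)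
    refine ⟨E * c, hE.mul hc, fun i h1 h2 => ?_, ?_⟩
    · rw [eval_mul]
      rcases Nat.lt_or_ge m i with h | h
      · have : i = m + 1 := by omega
        rw [this, hcz, mul_zero]
      · rw [hz i h1 h, zero_mul]
    · have h1 : ((E * c).natDegree : ℝ) ≤ E.natDegree + c.natDegree := by
        exact_mod_cast natDegree_mul_le
      have h2 : √(n / ((m + 1 : ℕ) : ℝ)) ≤ 2 * √n * (√((m + 1 : ℕ) : ℝ) - √m) := by
        rw [Real.sqrt_div hn.le]
        have hp : 0 < √((m + 1 : ℕ) : ℝ) := Real.sqrt_pos.2 (by positivity)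
        rw [div_le_iff₀ hp]
        have e1 : √((m + 1 : ℕ) : ℝ) ^ 2 = m + 1 := by
          rw [Real.sq_sqrt (by positivity)]; push_cast; ring
        have e2 : √(m : ℝ) ^ 2 = m := Real.sq_sqrt (by positivity)
        have : 1 ≤ 2 * (√((m + 1 : ℕ) : ℝ) - √m) * √((m + 1 : ℕ) : ℝ) := by
          nlinarith [sq_nonneg (√((m + 1 : ℕ) : ℝ) - √m)]
        nlinarith [Real.sqrt_nonneg n]
      push_cast at *
      linarith

theorem exists_E (n m L : ℕ) (hm : 1 ≤ m) (hmn : m ≤ n) (hL : n ≤ 2 ^ L) :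
    ∃ E : ℝ[X], Nice n E ∧ (∀ i : ℕ, 1 ≤ i → i ≤ m → E.eval (i : ℝ) = 0) ∧
      (∀ y ∈ Set.Icc (m : ℝ) n, (n : ℝ) * E.eval y ^ 2 ≤ (1 / 2) ^ (m + 1)) ∧
      (E.natDegree : ℝ) ≤ (5 + 2 * L) * (√n * √m) := by
  have hm' : (1 : ℝ) ≤ m := by exact_mod_cast hm
  have hmn' : (m : ℝ) ≤ n := by exact_mod_cast hmn
  have hn' : (0 : ℝ) < n := by linarith
  obtain ⟨E, hE, hz, hdeg⟩ := exists_zeros_poly n hn' m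
  obtain ⟨b, hb, hbs, hbd⟩ := exists_half_poly n m (by linarith) hmn'
  refine ⟨E * b ^ (m + L), hE.mul (hb.pow _), fun i h1 h2 => ?_, fun y hy => ?_, ?_⟩
  · rw [eval_mul, hz i h1 h2, zero_mul]
  · have h1 : |E.eval y| ≤ 1 := hE.2 y ⟨by linarith [hy.1], hy.2⟩
    have h2 := hbs y hy
    have h3 : |(E * b ^ (m + L)).eval y| ≤ (1 / 2) ^ (m + L) := by
      rw [eval_mul, eval_pow, abs_mul, abs_pow]
      calc _ ≤ 1 * (1 / 2 : ℝ) ^ (m + L) := by gcongr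
        _ = _ := one_mul _
    have h4 : (E * b ^ (m + L)).eval y ^ 2 ≤ ((1 / 2) ^ (m + L)) ^ 2 := by
      rw [← sq_abs]; gcongr
    have h5 : (n : ℝ) ≤ 2 ^ L := by exact_mod_cast hL
    calc (n : ℝ) * (E * b ^ (m + L)).eval y ^ 2 ≤ 2 ^ L * ((1 / 2) ^ (m + L)) ^ 2 := by gcongr
      _ = (2 * (1 / 2)) ^ L * ((1 / 2 : ℝ) ^ L * (1 / 2) ^ (2 * m)) := by
          rw [mul_pow]; ring
      _ ≤ 1 * (1 * (1 / 2) ^ (2 * m)) := by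
          have h6 : (1 / 2 : ℝ) ^ L ≤ 1 := pow_le_one₀ (by norm_num) (by norm_num)
          rw [show (2 * (1 / 2) : ℝ) = 1 by norm_num, one_pow]
          gcongr
      _ = (1 / 2) ^ (2 * m) := by ring
      _ ≤ (1 / 2) ^ (m + 1) := pow_le_pow_of_le_one (by norm_num) (by norm_num) (by omega)
  · have h1 : ((E * b ^ (m + L)).natDegree : ℝ) ≤ E.natDegree + (m + L) * b.natDegree := by
      have := (natDegree_mul_le (p := E) (q := b ^ (m + L))).trans
        (Nat.add_le_add_left (natDegree_pow_le (p := b) (n := m + L)) _)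
      exact_mod_cast this
    set u := √(n : ℝ)
    set v := √(m : ℝ)
    have hv1 : 1 ≤ v := Real.one_le_sqrt.2 hm'
    have huv : v ≤ u := Real.sqrt_le_sqrt hmn'
    have hvv : v * v = m := Real.mul_self_sqrt (by linarith)
    have hq : √((n : ℝ) / m) = u / v := Real.sqrt_div hn'.le _
    have h2 : (b.natDegree : ℝ) ≤ 2 * (u / v) := by
      have : 1 ≤ u / v := (one_le_div (by linarith)).2 huv
      rw [hq] at hbd; linarith
    have h3 : ((m : ℝ) + L) * b.natDegree ≤ (1 + L) * (2 * (u * v)) := by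
      calc ((m : ℝ) + L) * b.natDegree ≤ ((1 + L) * (v * v)) * (2 * (u / v)) := by
            apply mul_le_mul _ h2 (by positivity) (by positivity)
            rw [hvv]
            have : (0 : ℝ) ≤ L := by positivity
            nlinarith
        _ = (1 + L) * (2 * (u * v)) := by field_simp
    have h4 : (m : ℝ) ≤ u * v := by rw [← hvv]; gcongr
    nlinarith

/-- the slack matrix `S(U,M) = |δ(U) ∩ M| - 1` of the perfect matching
polytope admits an entrywise exponentially-close approximation `S̃` of psd rank at most
`2^{C n^{1/2+ε} (log n)²}`: entries with `|δ(U) ∩ M| > (n/2)^{2ε}` are approximated from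
below within `2^{-(n/2)^{2ε}}`, and all other entries are reproduced exactly. -/
theorem matching_polytope_psd_approximation (ε : ℝ) (hε : 0 < ε) :
    ∃ C : ℝ, 0 < C ∧
      ∀ n : ℕ, Even n → 2 ≤ n →
        ∀ S : Matrix {U : Finset (Fin n) // Odd U.card} {π : Equiv.Perm (Fin n) // IsPM π} ℝ,
          (∀ U π, S U π = (cutCard U.1 π.1 : ℝ) - 1) →
          ∃ St : Matrix {U : Finset (Fin n) // Odd U.card} {π : Equiv.Perm (Fin n) // IsPM π} ℝ,
            (∀ U π, 0 ≤ St U π) ∧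
            (psdRank St : ℝ) ≤ 2 ^ (C * (n : ℝ) ^ ((1 : ℝ) / 2 + ε) * (Real.log n) ^ 2) ∧
            ∀ U π,
              (((n : ℝ) / 2) ^ (2 * ε) < (cutCard U.1 π.1 : ℝ) →
                S U π - 2 ^ (-(((n : ℝ) / 2) ^ (2 * ε))) ≤ St U π ∧ St U π ≤ S U π) ∧
              ((cutCard U.1 π.1 : ℝ) ≤ ((n : ℝ) / 2) ^ (2 * ε) →
                St U π = S U π) := by
  have hl2 : 0 < Real.log 2 := Real.log_pos (by norm_num)
  refine ⟨38 / (Real.log 2) ^ 2, by positivity, ?_⟩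
  intro n _ hn2 S hS
  have hn2' : (2 : ℝ) ≤ n := by exact_mod_cast hn2
  set t : ℝ := ((n : ℝ) / 2) ^ (2 * ε) with ht
  have ht1 : 1 ≤ t := Real.one_le_rpow (by linarith) (by linarith)
  set m : ℕ := min ⌊t⌋₊ n with hm
  have hm1 : 1 ≤ m := le_min (Nat.one_le_floor_iff _ |>.2 ht1) (by omega)
  have hmn : m ≤ n := min_le_right _ _
  have hmt : (m : ℝ) ≤ t :=
    le_trans (by exact_mod_cast min_le_left _ _) (Nat.floor_le (by linarith))
  set L : ℕ := Nat.clog 2 n with hL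
  obtain ⟨E, hE, hz, hs, hdeg⟩ := exists_E n m L hm1 hmn (Nat.le_pow_clog (by norm_num) n)
  set p : ℝ[X] := (X * (1 - E ^ 2)).comp (X - C 1) with hp
  have hev : ∀ x, p.eval x = (x - 1) * (1 - E.eval (x - 1) ^ 2) := by
    intro x; simp [hp]
  have hpos : ∀ x ∈ Set.Icc (0 : ℝ) n, 0 ≤ p.eval x := by
    intro x hx
    rw [hev]
    rcases le_total (x - 1) 0 with h | h
    · have h1 := hE.1 _ h
      exact mul_nonneg_of_nonpos_of_nonpos h (by nlinarith)
    · have h1 := hE.2 _ ⟨h, by linarith [hx.2]⟩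
      have h2 := (sq_le_one_iff_abs_le_one _).2 h1
      exact mul_nonneg h (by linarith)
  obtain ⟨d, hd, hfac⟩ := poly_psd (by omega) p.natDegree p rfl hpos
  refine ⟨_, fun U π => ?_, le_trans (b := (d : ℝ)) (by exact_mod_cast Nat.sInf_le hfac) ?_,
    fun U π => ?_⟩
  · exact hpos _ ⟨by positivity, by exact_mod_cast cutCard_le _ _⟩
  · set l : ℝ := Real.logb 2 n with hl
    have hl1 : 1 ≤ l := by
      rw [hl, Real.le_logb_iff_rpow_le (by norm_num) (by linarith)]; simpa using hn2'
    have hll : l = Real.log n / Real.log 2 := rfl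
    have hLl : (L : ℝ) ≤ l + 1 := by
      have h1 : 2 ^ (L - 1) < n := Nat.pow_pred_clog_lt_self (by norm_num) (by omega)
      have h2 : ((L - 1 : ℕ) : ℝ) ≤ l := by
        rw [hl, Real.le_logb_iff_rpow_le (by norm_num) (by linarith), Real.rpow_natCast]
        exact_mod_cast h1.le
      have h3 : (L : ℝ) ≤ ((L - 1 : ℕ) : ℝ) + 1 := by
        have : L ≤ (L - 1) + 1 := by omega
        exact_mod_cast this
      linarith
    set w : ℝ := (n : ℝ) ^ ((1 : ℝ) / 2 + ε) with hw
    have hw1 : 1 ≤ w := Real.one_le_rpow (by linarith) (by linarith)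
    have hsw : √(n : ℝ) * √(m : ℝ) ≤ w := by
      rw [hw, Real.rpow_add (by linarith), ← Real.sqrt_eq_rpow]
      gcongr
      rw [Real.sqrt_le_left (by positivity)]
      calc (m : ℝ) ≤ t := hmt
        _ ≤ (n : ℝ) ^ (2 * ε) := by
            rw [ht]; gcongr; linarith
        _ = ((n : ℝ) ^ ε) ^ 2 := by
            rw [mul_comm, Real.rpow_mul (by positivity)]; norm_num
    have hpd : (p.natDegree : ℝ) ≤ 19 * l * w := by
      have h1 : p.natDegree ≤ 1 + 2 * E.natDegree := by
        rw [hp, natDegree_comp, natDegree_X_sub_C, mul_one]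
        refine natDegree_mul_le.trans ?_
        gcongr
        · exact natDegree_X_le
        · refine (natDegree_sub_le _ _).trans ?_
          simpa using natDegree_pow_le (p := E) (n := 2)
      have h2 : (p.natDegree : ℝ) ≤ 1 + 2 * E.natDegree := by exact_mod_cast h1
      have h3 : (E.natDegree : ℝ) ≤ (5 + 2 * L) * w := hdeg.trans (by gcongr)
      have h4 : (5 + 2 * (L : ℝ)) * w ≤ (5 + 2 * (l + 1)) * w := by gcongr
      nlinarith [mul_le_mul hl1 hw1 (by norm_num) (by linarith)]
    have h2n : (2 : ℝ) ^ l = n := Real.rpow_logb (by norm_num) (by norm_num) (by linarith)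
    calc (d : ℝ) ≤ ((n : ℝ) * n) ^ p.natDegree := by exact_mod_cast hd
      _ = (2 : ℝ) ^ (2 * l * p.natDegree) := by
          rw [← Real.rpow_natCast, Real.rpow_mul (by norm_num), two_mul,
            Real.rpow_add (by norm_num), h2n]
      _ ≤ _ := by
          apply Real.rpow_le_rpow_of_exponent_le (by norm_num)
          calc 2 * l * p.natDegree ≤ 2 * l * (19 * l * w) := by gcongr
            _ = _ := by rw [hll]; field_simp; ring
  · have hk1 : 1 ≤ cutCard U.1 π.1 := cutCard_pos _ U.2 _ π.2
    have hkn : cutCard U.1 π.1 ≤ n := cutCard_le _ _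
    rw [hS]
    simp only [Matrix.of_apply, hev]
    generalize cutCard U.1 π.1 = k at hk1 hkn
    obtain ⟨j, rfl⟩ : ∃ j, k = j + 1 := ⟨k - 1, by omega⟩
    have hkj : ((j + 1 : ℕ) : ℝ) - 1 = j := by push_cast; ring
    rw [hkj]
    have hjn : (j : ℝ) + 1 ≤ n := by exact_mod_cast hkn
    have hj0 : (0 : ℝ) ≤ j := by positivity
    refine ⟨fun hk => ?_, fun hk => ?_⟩
    · have hft : ⌊t⌋₊ < j + 1 := (Nat.floor_lt (by linarith)).2 hk
      have hmf : m = ⌊t⌋₊ := min_eq_left (by omega)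
      have hmj : (m : ℝ) ≤ j := by
        have : m ≤ j := by omega
        exact_mod_cast this
      have h1 := hs j ⟨hmj, by linarith⟩
      have h2 : ((1 : ℝ) / 2) ^ (m + 1) ≤ 2 ^ (-t) := by
        rw [Real.rpow_neg (by norm_num), one_div, inv_pow, ← Real.rpow_natCast]
        gcongr
        · norm_num
        · rw [hmf]; push_cast; exact (Nat.lt_floor_add_one t).le
      have h3 : (j : ℝ) * E.eval (j : ℝ) ^ 2 ≤ n * E.eval (j : ℝ) ^ 2 := by
        gcongr; linarith
      have h4 : 0 ≤ (j : ℝ) * E.eval (j : ℝ) ^ 2 := by positivity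
      constructor <;> linarith
    · have hf : j + 1 ≤ ⌊t⌋₊ := Nat.le_floor hk
      have hjm : j ≤ m := by
        have : j + 1 ≤ m := le_min hf hkn
        omega
      rcases Nat.eq_zero_or_pos j with h | h
      · simp [h]
      · rw [hz j h hjm]; ring
end
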